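/- If P ∈ 𝒞 is a rank-one orthogonal projection, then there exists S ∈ M such that P = S ∘ E ∘ S*. -/

import Mathlib

open scoped InnerProductSpace
open ContinuousLinearMap

/-- Operators in the span of `M E M`, with `E` of range in `ℂ ∙ x`, have range in the orbit `M x`. -/
theorem exists_mem_apply_eq_of_mem_span {H : Type*} [NormedAddCommGroup H]
    [InnerProductSpace ℂ H] [CompleteSpace H] (M : VonNeumannAlgebra H) (x : H)
    (E : H →L[ℂ] H) (hE : ∀ y : H, E y = ⟪x, y⟫_ℂ • x) {T : H →L[ℂ] H}
    (hT : T ∈ Submodule.span ℂ {T : H →L[ℂ] H | ∃ A ∈ M, ∃ B ∈ M, T = A ∘L E ∘L B}) (y : H) :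
    ∃ S ∈ M, T y = S x := by
  induction hT using Submodule.span_induction with
  | mem T hT =>
    obtain ⟨A, hA, B, -, rfl⟩ := hT
    exact ⟨⟪x, B y⟫_ℂ • A, M.toStarSubalgebra.smul_mem hA _, by simp [hE]⟩
  | zero => exact ⟨0, M.toStarSubalgebra.zero_mem, by simp⟩
  | add T₁ T₂ _ _ h₁ h₂ =>
    obtain ⟨S₁, hS₁, e₁⟩ := h₁
    obtain ⟨S₂, hS₂, e₂⟩ := h₂
    exact ⟨S₁ + S₂, M.toStarSubalgebra.add_mem hS₁ hS₂, by simp [e₁, e₂]⟩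
  | smul c T _ h =>
    obtain ⟨S, hS, e⟩ := h
    exact ⟨c • S, M.toStarSubalgebra.smul_mem hS c, by simp [e]⟩

/-- every rank-one orthogonal projection in `𝒞` has the form `S ∘ E ∘ S*`
for some `S ∈ M`. -/
theorem stmt3 {H : Type*} [NormedAddCommGroup H] [InnerProductSpace ℂ H] [CompleteSpace H]
    (M : VonNeumannAlgebra H)
    (hfactor : ∀ T ∈ M, T ∈ M.commutant → ∃ c : ℂ, T = c • (1 : H →L[ℂ] H))
    (x : H) (hx : ‖x‖ = 1)
    (hcyclic : closure {y : H | ∃ A ∈ M, y = A x} = Set.univ)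
    (hseparating : ∀ A ∈ M, A x = 0 → A = 0)
    (E : H →L[ℂ] H) (hE : ∀ y : H, E y = ⟪x, y⟫_ℂ • x)
    (𝒞 : Submodule ℂ (H →L[ℂ] H))
    (h𝒞 : 𝒞 = Submodule.span ℂ {T : H →L[ℂ] H | ∃ A ∈ M, ∃ B ∈ M, T = A ∘L E ∘L B})
    (P : H →L[ℂ] H) (hP𝒞 : P ∈ 𝒞) (hPsa : IsSelfAdjoint P) (hPidem : P ∘L P = P)
    (hPrank : Module.finrank ℂ (LinearMap.range (P : H →ₗ[ℂ] H)) = 1) :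
    ∃ S ∈ M, P = S ∘L E ∘L ContinuousLinearMap.adjoint S := by
  subst h𝒞
  obtain ⟨⟨v, w, hw⟩, hv0, hv⟩ := finrank_eq_one_iff'.mp hPrank
  have hv0' : v ≠ 0 := fun h => hv0 (Subtype.ext h)
  have hw : P w = v := hw
  have hPv : P v = v := by rw [← hw]; exact DFunLike.congr_fun hPidem w
  obtain ⟨S, hS, hSv⟩ := exists_mem_apply_eq_of_mem_span M x E hE hP𝒞 v
  rw [hPv] at hSv
  have hn : ((‖v‖ : ℝ) : ℂ) ≠ 0 := by simpa using hv0'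
  refine ⟨((‖v‖ : ℝ) : ℂ)⁻¹ • S, M.toStarSubalgebra.smul_mem hS _, ?_⟩
  ext y
  obtain ⟨c, hc⟩ := hv ⟨P y, y, rfl⟩
  have hc : c • v = P y := congrArg Subtype.val hc
  have key : c * ((‖v‖ : ℝ) : ℂ) ^ 2 = ⟪v, y⟫_ℂ := by
    have h : ⟪P v, y⟫_ℂ = ⟪v, P y⟫_ℂ := hPsa.isSymmetric v y
    rw [hPv, ← hc, inner_smul_right, inner_self_eq_norm_sq_to_K] at h
    exact h.symm
  simp only [ContinuousLinearMap.comp_apply, hE, ContinuousLinearMap.adjoint_inner_right,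
    map_smul, _root_.smul_apply, ← hSv, inner_smul_left, ← hc, smul_smul, ← key]
  congr 1
  simp
  field_simp
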